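/- Every continuous k-bilinear map l : k((t)) × k((t)) → k (continuous with respect to the t-adic topology on k((t)) and the discrete topology on k) satisfying l(f∘u, g∘u) = l(f, g) for all f, g ∈ k((t)) and all u ∈ Aut O is a constant multiple of the map c(f,g) = −Res(f dg); in particular, every such l is skew-symmetric. -/

import Mathlib

noncomputable section
attribute [local instance] Classical.propDecidable

/-- The 2-cocycle `c(f, g) = -Res(f dg)` on the geometric loop algebra `K = k((t))`:
for `f = ∑ a_n tⁿ` and `g = ∑ b_n tⁿ`, `Res(f dg)` is the coefficient of `t⁻¹` in
`f · g'`, i.e. `c(f, g) = -∑_{n ∈ ℤ} n · b_n · a_{-n}` (a finite sum). -/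
def laurentCocycle {k : Type} [Field k] (f g : LaurentSeries k) : k :=
  -∑ᶠ n : ℤ, (n : k) * g.coeff n * f.coeff (-n)

namespace LaurentSeries

open PowerSeries HahnSeries

variable {k : Type*} [Field k]

theorem exists_coe_eq_of_coeff_neg_eq_zero {f : LaurentSeries k}
    (hf : ∀ m : ℤ, m < 0 → f.coeff m = 0) : ∃ F : k⟦X⟧, (F : LaurentSeries k) = f := by
  refine ⟨PowerSeries.mk fun n => f.coeff n, ?_⟩
  ext n
  rw [PowerSeries.coeff_coe]
  split_ifs with h
  · rw [hf n h]
  · rw [PowerSeries.coeff_mk, Int.natAbs_of_nonneg (not_lt.mp h)]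

/-- A power series `P = aX + O(X²)` with `a ≠ 0` induces an automorphism of `k((t))` preserving
`k[[t]]` and sending `t` to `P`. -/
theorem exists_algEquiv_single_one_eq (P : k⟦X⟧) (hP : P.constantCoeff = 0)
    (hP' : IsUnit (P.coeff 1)) :
    ∃ σ : LaurentSeries k ≃ₐ[k] LaurentSeries k,
      (∀ f : LaurentSeries k, (∀ m : ℤ, m < 0 → f.coeff m = 0) →
        ∀ m : ℤ, m < 0 → (σ f).coeff m = 0) ∧
      (∀ f : LaurentSeries k, (∀ m : ℤ, m < 0 → f.coeff m = 0) →
        ∀ m : ℤ, m < 0 → (σ.symm f).coeff m = 0) ∧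
      σ (single 1 1) = (P : LaurentSeries k) := by
  have hsP : HasSubst P := HasSubst.of_constantCoeff_zero' hP
  have hsQ : HasSubst (P.substInvOfIsUnit hP') := HasSubst.substInvOfIsUnit P hP'
  let φ : k⟦X⟧ ≃ₐ[k] k⟦X⟧ := AlgEquiv.ofAlgHom
    (substAlgHom hsP) (substAlgHom hsQ)
    (by
      ext1 f
      simp only [AlgHom.comp_apply, AlgHom.id_apply, coe_substAlgHom]
      rw [subst_comp_subst_apply hsQ hsP, subst_substInvOfIsUnit_left P hP hP', X_subst])
    (by
      ext1 f
      simp only [AlgHom.comp_apply, AlgHom.id_apply, coe_substAlgHom]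
      rw [subst_comp_subst_apply hsP hsQ, subst_substInvOfIsUnit_right P hP hP', X_subst])
  have : @IsScalarTower k k⟦X⟧ (LaurentSeries k) Algebra.toSMul Algebra.toSMul Algebra.toSMul := by
    refine IsScalarTower.of_algebraMap_eq fun a => ?_
    rw [HahnSeries.algebraMap_apply']
    rfl
  have key : ∀ ψ : k⟦X⟧ ≃ₐ[k] k⟦X⟧, ∀ F : k⟦X⟧,
      (IsFractionRing.algEquivOfAlgEquiv ψ : LaurentSeries k ≃ₐ[k] LaurentSeries k)
        (F : LaurentSeries k) = (ψ F : k⟦X⟧) := fun ψ F =>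
    IsFractionRing.algEquivOfAlgEquiv_algebraMap ψ F
  have integral : ∀ ψ : k⟦X⟧ ≃ₐ[k] k⟦X⟧, ∀ f : LaurentSeries k,
      (∀ m : ℤ, m < 0 → f.coeff m = 0) → ∀ m : ℤ, m < 0 →
      ((IsFractionRing.algEquivOfAlgEquiv ψ : LaurentSeries k ≃ₐ[k] LaurentSeries k) f).coeff m
        = 0 := by
    intro ψ f hf m hm
    obtain ⟨F, rfl⟩ := exists_coe_eq_of_coeff_neg_eq_zero hf
    rw [key, PowerSeries.coeff_coe, if_pos hm]
  refine ⟨IsFractionRing.algEquivOfAlgEquiv φ, integral φ, integral φ.symm, ?_⟩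
  rw [← PowerSeries.coe_X, key]
  congr 1
  exact substAlgHom_X hsP

/-- The integral powers of `1 + X ^ (m + 1)` up to order `m + 1`. -/
theorem exists_one_add_X_pow_zpow_eq (m : ℕ) (n : ℤ) :
    ∃ r : k⟦X⟧, ((1 + X ^ (m + 1) : k⟦X⟧) : LaurentSeries k) ^ n =
      ((1 + (n : k⟦X⟧) * X ^ (m + 1) + X ^ (m + 2) * r : k⟦X⟧) : LaurentSeries k) := by
  have hW : (1 + X ^ (m + 1) : k⟦X⟧) * (1 + X ^ (m + 1) : k⟦X⟧)⁻¹ = 1 :=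
    PowerSeries.mul_inv_cancel _ (by simp)
  have hW0 : ((1 + X ^ (m + 1) : k⟦X⟧) : LaurentSeries k) ≠ 0 := by
    intro h
    have h1 := congrArg (HahnSeries.ofPowerSeries ℤ k) hW
    rw [PowerSeries.coe_mul, h, zero_mul, PowerSeries.coe_one] at h1
    exact zero_ne_one h1
  induction n with
  | zero => exact ⟨0, by simp⟩
  | succ n ih =>
    obtain ⟨r, hr⟩ := ih
    refine ⟨(n : k⟦X⟧) * X ^ m + r * (1 + X ^ (m + 1)), ?_⟩
    rw [zpow_add_one₀ hW0, hr, ← PowerSeries.coe_mul]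
    congr 1
    push_cast
    ring
  | pred n ih =>
    obtain ⟨r, hr⟩ := ih
    refine ⟨(r + ((n : k⟦X⟧) + 1) * X ^ m) * (1 + X ^ (m + 1) : k⟦X⟧)⁻¹, ?_⟩
    apply mul_right_cancel₀ hW0
    rw [zpow_sub_one₀ hW0, inv_mul_cancel_right₀ hW0, hr, ← PowerSeries.coe_mul]
    congr 1
    push_cast
    linear_combination (-(X ^ (m + 2) * (r + ((n : k⟦X⟧) + 1) * X ^ m)) : k⟦X⟧) * hW

/-- The coefficients of `(t + t ^ (m + 2)) ^ n` in degrees up to `n + m + 1`. -/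
theorem coeff_X_add_X_pow_zpow (m : ℕ) (n d : ℤ) (hd : d ≤ n + m + 1) :
    (((X + X ^ (m + 2) : k⟦X⟧) : LaurentSeries k) ^ n).coeff d =
      if d = n then 1 else if d = n + m + 1 then (n : k) else 0 := by
  obtain ⟨r, hr⟩ := exists_one_add_X_pow_zpow_eq (k := k) m n
  have hfac : (X + X ^ (m + 2) : k⟦X⟧) = X * (1 + X ^ (m + 1)) := by ring
  have hn : (n : k⟦X⟧) = PowerSeries.C (n : k) := by simp
  rw [hfac, PowerSeries.coe_mul, mul_zpow, hr, PowerSeries.coe_X, ← RatFunc.single_zpow]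
  obtain ⟨e, rfl⟩ : ∃ e, d = e + n := ⟨d - n, by ring⟩
  rw [HahnSeries.coeff_single_mul_add, one_mul, PowerSeries.coeff_coe]
  rcases lt_or_ge e 0 with he | he
  · rw [if_pos he, if_neg (by omega), if_neg (by omega)]
  · lift e to ℕ using he
    rw [if_neg (by omega), Int.natAbs_natCast, hn]
    simp only [map_add, PowerSeries.coeff_one, PowerSeries.coeff_C_mul, PowerSeries.coeff_X_pow,
      PowerSeries.coeff_X_pow_mul']
    rw [if_neg (show ¬ m + 2 ≤ e by omega)]
    by_cases h0 : e = 0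
    · subst h0
      simp
    · by_cases h1 : e = m + 1
      · subst h1
        rw [if_neg h0, if_pos rfl, if_neg (by omega), if_pos (by push_cast; ring)]
        simp
      · rw [if_neg h0, if_neg h1, if_neg (by omega), if_neg (by omega)]
        simp

/-- A linear functional killing `t ^ N k[[t]]` is determined by its values on the powers of `t`. -/
theorem linearMap_apply_eq_finsum (φ : LaurentSeries k →ₗ[k] k)
    (hφ : ∃ N : ℤ, ∀ f : LaurentSeries k, (∀ m : ℤ, m < N → f.coeff m = 0) → φ f = 0)
    (f : LaurentSeries k) : φ f = ∑ᶠ n : ℤ, f.coeff n * φ (single n 1) := by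
  obtain ⟨N, hN⟩ := hφ
  have hlow : ∀ n < f.order, f.coeff n = 0 := fun n hn => coeff_eq_zero_of_lt_order hn
  rw [finsum_eq_sum_of_support_subset (s := Finset.Ico f.order N)]
  · rw [← sub_eq_zero]
    have hsum : ∑ n ∈ Finset.Ico f.order N, f.coeff n * φ (single n 1) =
        φ (∑ n ∈ Finset.Ico f.order N, f.coeff n • single n (1 : k)) := by
      simp only [map_sum, map_smul, smul_eq_mul]
    rw [hsum, ← map_sub]
    apply hN
    intro m hm
    rw [HahnSeries.coeff_sub, HahnSeries.coeff_sum]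
    simp only [HahnSeries.coeff_smul, HahnSeries.coeff_single, smul_eq_mul, mul_ite, mul_one,
      mul_zero, Finset.sum_ite_eq, Finset.mem_Ico, hm, and_true]
    split_ifs with h
    · exact sub_self _
    · rw [hlow m (not_le.mp h), sub_zero]
  · intro n hn
    rw [Function.mem_support] at hn
    rw [Finset.coe_Ico, Set.mem_Ico]
    constructor
    · by_contra! h
      exact hn (by rw [hlow n h, zero_mul])
    · by_contra! h
      refine hn ?_
      rw [hN _ fun m hm => coeff_single_of_ne (by omega), mul_zero]

/-- A separately continuous bilinear form which vanishes on `(t ^ i, t ^ j)` for `i + j ≠ 0` is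
determined by its values on the pairs `(t ^ (-n), t ^ n)`. -/
theorem bilinear_apply_eq_finsum (l : LaurentSeries k →ₗ[k] LaurentSeries k →ₗ[k] k)
    (hleft : ∀ g : LaurentSeries k, ∃ N : ℤ, ∀ f : LaurentSeries k,
        (∀ m : ℤ, m < N → f.coeff m = 0) → l f g = 0)
    (hright : ∀ f : LaurentSeries k, ∃ N : ℤ, ∀ g : LaurentSeries k,
        (∀ m : ℤ, m < N → g.coeff m = 0) → l f g = 0)
    (hoff : ∀ i j : ℤ, i + j ≠ 0 → l (single i 1) (single j 1) = 0)
    (f g : LaurentSeries k) :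
    l f g = ∑ᶠ n : ℤ, g.coeff n * (f.coeff (-n) * l (single (-n) 1) (single n 1)) := by
  rw [linearMap_apply_eq_finsum (l f) (hright f) g]
  refine finsum_congr fun n => ?_
  congr 1
  have h := linearMap_apply_eq_finsum (l.flip (single n 1)) (hleft _) f
  simp only [LinearMap.flip_apply] at h
  rw [h, finsum_eq_single _ (-n)]
  intro i hi
  rw [hoff i n (by omega), mul_zero]

/-- Invariance under `t ↦ t + t ^ (m + 2)`. -/
theorem invariant_recurrence (l : LaurentSeries k →ₗ[k] LaurentSeries k →ₗ[k] k)
    (hleft : ∀ g : LaurentSeries k, ∃ N : ℤ, ∀ f : LaurentSeries k,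
        (∀ m : ℤ, m < N → f.coeff m = 0) → l f g = 0)
    (hright : ∀ f : LaurentSeries k, ∃ N : ℤ, ∀ g : LaurentSeries k,
        (∀ m : ℤ, m < N → g.coeff m = 0) → l f g = 0)
    (hoff : ∀ i j : ℤ, i + j ≠ 0 → l (single i 1) (single j 1) = 0)
    (hinv : ∀ P : k⟦X⟧, P.constantCoeff = 0 → IsUnit (P.coeff 1) → ∀ i j : ℤ,
      l ((P : LaurentSeries k) ^ i) ((P : LaurentSeries k) ^ j) = l (single i 1) (single j 1))
    (m : ℕ) (i : ℤ) :
    (i : k) * l (single (i + m + 1) 1) (single (-(i + m + 1)) 1) =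
      (i + m + 1 : k) * l (single i 1) (single (-i) 1) := by
  have h := hinv (X + X ^ (m + 2)) (by simp)
    (by simp [PowerSeries.coeff_X_pow]) i (-(i + m + 1))
  rw [hoff _ _ (by omega), bilinear_apply_eq_finsum l hleft hright hoff,
    finsum_eq_sum_of_support_subset (s := {-(i + m + 1), -i}),
    Finset.sum_pair (by omega)] at h
  · rw [coeff_X_add_X_pow_zpow _ _ _ (by omega), coeff_X_add_X_pow_zpow _ _ _ (by omega),
      coeff_X_add_X_pow_zpow _ _ _ (by omega), coeff_X_add_X_pow_zpow _ _ _ (by omega),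
      if_pos rfl, if_neg (by omega), if_pos (by omega), if_neg (by omega), if_pos (by omega),
      if_pos (by omega)] at h
    simp only [neg_neg] at h
    push_cast at h
    linear_combination h
  · intro n hn
    rw [Function.mem_support] at hn
    have h1 : n ≤ -i := by
      by_contra! hlt
      refine hn ?_
      rw [coeff_X_add_X_pow_zpow m i (-n) (by omega), if_neg (by omega), if_neg (by omega)]
      simp
    have h2 : (((X + X ^ (m + 2) : k⟦X⟧) : LaurentSeries k) ^ (-(i + m + 1))).coeff n ≠ 0 :=
      left_ne_zero_of_mul hn
    rw [coeff_X_add_X_pow_zpow m _ n (by omega)] at h2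
    by_contra! hne
    simp only [Finset.coe_insert, Finset.coe_singleton, Set.mem_insert_iff,
      Set.mem_singleton_iff, not_or] at hne
    rw [if_neg hne.1, if_neg (by omega)] at h2
    exact h2 rfl

end LaurentSeries

theorem laurentCocycle_swap {k : Type} [Field k] (f g : LaurentSeries k) :
    laurentCocycle f g = -laurentCocycle g f := by
  unfold laurentCocycle
  rw [← finsum_neg_distrib, neg_neg, ← finsum_comp_equiv (Equiv.neg ℤ)]
  refine finsum_congr fun n => ?_
  simp only [Equiv.neg_apply, neg_neg]
  push_cast
  ring

/-- **Uniqueness of the `Aut 𝒪`-invariant cocycle** (Remark in Section 4.1): every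
continuous `k`-bilinear map `l : k((t)) × k((t)) → k` (continuous with respect to the
`t`-adic topology on `k((t))` and the discrete topology on `k`) satisfying
`l(f∘u, g∘u) = l(f, g)` for all `f, g ∈ k((t))` and all `u ∈ Aut 𝒪` — i.e. invariant
under every `k`-algebra automorphism `σ` of `k((t))` preserving the valuation ring
`𝒪 = k[[t]]` (together with its inverse) — is a constant multiple of the map
`c(f, g) = -Res(f dg)`; in particular, every such `l` is skew-symmetric. -/
theorem laurent_invariant_bilinear_form_unique (k : Type) [Field k] [IsAlgClosed k]
    [CharZero k]
    (l : LaurentSeries k →ₗ[k] LaurentSeries k →ₗ[k] k)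
    (hcont_left : ∀ g : LaurentSeries k, ∃ N : ℤ, ∀ f : LaurentSeries k,
        (∀ m : ℤ, m < N → f.coeff m = 0) → l f g = 0)
    (hcont_right : ∀ f : LaurentSeries k, ∃ N : ℤ, ∀ g : LaurentSeries k,
        (∀ m : ℤ, m < N → g.coeff m = 0) → l f g = 0)
    (hinv : ∀ σ : LaurentSeries k ≃ₐ[k] LaurentSeries k,
        (∀ f : LaurentSeries k, (∀ m : ℤ, m < 0 → f.coeff m = 0) →
          ∀ m : ℤ, m < 0 → (σ f).coeff m = 0) →
        (∀ f : LaurentSeries k, (∀ m : ℤ, m < 0 → f.coeff m = 0) →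
          ∀ m : ℤ, m < 0 → (σ.symm f).coeff m = 0) →
        ∀ f g : LaurentSeries k, l (σ f) (σ g) = l f g) :
    (∃ a : k, ∀ f g : LaurentSeries k, l f g = a * laurentCocycle f g) ∧
    (∀ f g : LaurentSeries k, l f g = -(l g f)) := by
  have hsubst : ∀ P : PowerSeries k, P.constantCoeff = 0 → IsUnit (P.coeff 1) → ∀ i j : ℤ,
      l ((P : LaurentSeries k) ^ i) ((P : LaurentSeries k) ^ j) =
        l (HahnSeries.single i 1) (HahnSeries.single j 1) := by
    intro P hP hP' i j
    obtain ⟨σ, h₁, h₂, h₃⟩ := LaurentSeries.exists_algEquiv_single_one_eq P hP hP'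
    rw [← h₃, ← map_zpow₀ σ, ← map_zpow₀ σ, hinv σ h₁ h₂, ← RatFunc.single_zpow,
      ← RatFunc.single_zpow]
  have hoff : ∀ i j : ℤ, i + j ≠ 0 →
      l (HahnSeries.single i 1) (HahnSeries.single j 1) = 0 := by
    intro i j hij
    have h := hsubst (PowerSeries.C 2 * PowerSeries.X) (by simp) (by simp) i j
    have hpow : ∀ n : ℤ, ((PowerSeries.C 2 * PowerSeries.X : PowerSeries k) :
        LaurentSeries k) ^ n = (2 : k) ^ n • HahnSeries.single n (1 : k) := by
      intro n
      rw [PowerSeries.coe_mul, mul_zpow, PowerSeries.coe_X, ← RatFunc.single_zpow,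
        PowerSeries.coe_C, ← map_zpow₀, HahnSeries.C_mul_eq_smul]
    rw [hpow, hpow, map_smul, map_smul, LinearMap.smul_apply, smul_eq_mul, smul_eq_mul,
      ← mul_assoc, ← zpow_add₀ two_ne_zero] at h
    have h2 : (2 : k) ^ (j + i) ≠ 1 := by
      intro h1
      have h1' : (2 : ℚ) ^ (j + i) = 1 := by
        apply (algebraMap ℚ k).injective
        simpa using h1
      rw [zpow_eq_one_iff_right₀ (by norm_num) (by norm_num)] at h1'
      omega
    have h3 : ((2 : k) ^ (j + i) - 1) *
        l (HahnSeries.single i 1) (HahnSeries.single j 1) = 0 := by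
      linear_combination h
    exact (mul_eq_zero.mp h3).resolve_left (sub_ne_zero.mpr h2)
  have hrec := LaurentSeries.invariant_recurrence l hcont_left hcont_right hoff hsubst
  have hdiag : ∀ n : ℤ, l (HahnSeries.single n 1) (HahnSeries.single (-n) 1) =
      (n : k) * l (HahnSeries.single 1 1) (HahnSeries.single (-1) 1) := by
    intro n
    rcases lt_trichotomy n 1 with h | rfl | h
    · obtain ⟨m, hm⟩ : ∃ m : ℕ, n + m + 1 = 1 := ⟨(-n).toNat, by omega⟩
      have := hrec m n
      rw [hm, show (n + m + 1 : k) = 1 by exact_mod_cast congrArg (Int.cast : ℤ → k) hm,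
        one_mul] at this
      exact this.symm
    · simp
    · obtain ⟨m, rfl⟩ : ∃ m : ℕ, n = 1 + m + 1 := ⟨(n - 2).toNat, by omega⟩
      simpa using hrec m 1
  have hmain : ∀ f g : LaurentSeries k, l f g =
      l (HahnSeries.single 1 1) (HahnSeries.single (-1) 1) * laurentCocycle f g := by
    intro f g
    rw [LaurentSeries.bilinear_apply_eq_finsum l hcont_left hcont_right hoff, laurentCocycle,
      ← finsum_neg_distrib, mul_finsum]
    refine finsum_congr fun n => ?_
    have := hdiag (-n)
    rw [neg_neg] at this
    rw [this]
    push_cast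
    ring
  refine ⟨⟨_, hmain⟩, fun f g => ?_⟩
  rw [hmain f g, hmain g f, laurentCocycle_swap, mul_neg]
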